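/- Let A and B be generators of irreducible continuous-time Markov chains on a finite set S, both reversible with respect to the same probability measure μ with full support, and assume that the total jump rate from each state is the same for A and B, i.e. A_{ii} = B_{ii} for every i ∈ S. For v with Σ_i μ_i v_i = 0 write Q_A(v) = ⟨v, u⟩_μ where u is any solution of A u = −v (this value is well defined), and similarly Q_B(v). Then either A = B, or there exist v, w with Σ_i μ_i v_i = Σ_i μ_i w_i = 0 such that Q_A(v) > Q_B(v) and Q_A(w) < Q_B(w). -/

import Mathlib

open Matrix Finset

section ReversibleGenerator

variable {S : Type*} [Fintype S] {A B : Matrix S S ℝ} {μ : S → ℝ}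

/-- A reversible matrix is symmetric for the weighted inner product. -/
lemma sum_mul_mulVec_comm_of_reversible (hrev : ∀ i j, μ i * A i j = μ j * A j i)
    (f g : S → ℝ) :
    ∑ i, μ i * f i * (A *ᵥ g) i = ∑ i, μ i * g i * (A *ᵥ f) i := by
  simp only [mulVec, dotProduct, mul_sum]
  rw [sum_comm]
  refine sum_congr rfl fun i _ ↦ sum_congr rfl fun j _ ↦ ?_
  linear_combination f j * g i * hrev j i

/-- Stationarity: the image of a reversible matrix with zero row sums has mean zero. -/
lemma sum_mul_mulVec_eq_zero_of_reversible (hrow : ∀ i, ∑ j, A i j = 0)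
    (hrev : ∀ i j, μ i * A i j = μ j * A j i) (f : S → ℝ) :
    ∑ i, μ i * (A *ᵥ f) i = 0 := by
  have h := sum_mul_mulVec_comm_of_reversible hrev (fun _ ↦ 1) f
  simpa [mulVec, dotProduct, hrow] using h

/-- The Dirichlet form of a reversible generator is nonnegative. -/
lemma sum_mul_mulVec_self_nonpos_of_reversible (hμ : ∀ i, 0 < μ i)
    (hoff : ∀ i j, i ≠ j → 0 ≤ A i j) (hrow : ∀ i, ∑ j, A i j = 0)
    (hrev : ∀ i j, μ i * A i j = μ j * A j i) (f : S → ℝ) :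
    ∑ i, μ i * f i * (A *ᵥ f) i ≤ 0 := by
  have hdir : 0 ≤ ∑ i, ∑ j, μ i * A i j * (f i - f j) ^ 2 := by
    refine sum_nonneg fun i _ ↦ sum_nonneg fun j _ ↦ ?_
    rcases eq_or_ne i j with rfl | hij
    · simp
    · exact mul_nonneg (mul_nonneg (hμ i).le (hoff i j hij)) (sq_nonneg _)
  have hsq : ∑ i, ∑ j, μ i * A i j * f i ^ 2 = 0 :=
    sum_eq_zero fun i _ ↦ by rw [← sum_mul, ← mul_sum, hrow]; simp
  have hsq' : ∑ i, ∑ j, μ i * A i j * f j ^ 2 = 0 := by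
    rw [sum_comm, ← hsq]
    exact sum_congr rfl fun i _ ↦ sum_congr rfl fun j _ ↦ by rw [hrev]
  have hexp : ∑ i, ∑ j, μ i * A i j * (f i - f j) ^ 2 =
      ∑ i, ∑ j, μ i * A i j * f i ^ 2 + ∑ i, ∑ j, μ i * A i j * f j ^ 2
        - 2 * ∑ i, μ i * f i * (A *ᵥ f) i := by
    simp only [mulVec, dotProduct, mul_sum, ← sum_add_distrib, ← sum_sub_distrib]
    exact sum_congr rfl fun i _ ↦ sum_congr rfl fun j _ ↦ by ring
  linarith

/-- The Poisson equation of an ergodic reversible generator is solvable for mean-zero data. -/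
lemma exists_mulVec_eq_of_sum_mul_eq_zero (hμ_sum : ∑ i, μ i = 1)
    (hrow : ∀ i, ∑ j, A i j = 0) (hrev : ∀ i j, μ i * A i j = μ j * A j i)
    (herg : ∀ f : S → ℝ, A *ᵥ f = 0 → ∃ c : ℝ, ∀ i, f i = c)
    (g : S → ℝ) (hg : ∑ i, μ i * g i = 0) : ∃ f, A *ᵥ f = g := by
  let L : (S → ℝ) →ₗ[ℝ] (S → ℝ) := (A + Matrix.of fun _ j ↦ μ j).mulVecLin
  have hL (f : S → ℝ) (i : S) : L f i = (A *ᵥ f) i + ∑ j, μ j * f j := by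
    simp [L, mulVec, dotProduct]
  have hmean (f : S → ℝ) : ∑ i, μ i * L f i = ∑ j, μ j * f j := by
    simp only [hL, mul_add, sum_add_distrib, ← sum_mul, hμ_sum,
      sum_mul_mulVec_eq_zero_of_reversible hrow hrev, zero_add, one_mul]
  have hinj : Function.Injective L := by
    rw [← LinearMap.ker_eq_bot, LinearMap.ker_eq_bot']
    intro f hf
    have hf0 : ∑ j, μ j * f j = 0 := by rw [← hmean, hf]; simp
    obtain ⟨c, hc⟩ := herg f (by
      ext i
      have h := hL f i
      rw [hf, hf0, add_zero] at h
      exact h.symm)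
    have hc0 : c = 0 := by simpa [hc, ← sum_mul, hμ_sum] using hf0
    ext i
    simp [hc, hc0]
  obtain ⟨f, hf⟩ := LinearMap.injective_iff_surjective.mp hinj g
  have hf0 : ∑ j, μ j * f j = 0 := by rw [← hmean, hf, hg]
  refine ⟨f, funext fun i ↦ ?_⟩
  rw [← hf, hL, hf0, add_zero]

/-- If the Dirichlet form of `B` is smaller than that of `A` at `u`, then the quadratic form
`v ↦ ⟨v, -A⁻¹ v⟩` is smaller than `v ↦ ⟨v, -B⁻¹ v⟩` at `v = -A u`. -/
lemma exists_poisson_lt_of_dirichlet_lt (hμ_pos : ∀ i, 0 < μ i) (hμ_sum : ∑ i, μ i = 1)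
    (hA_row : ∀ i, ∑ j, A i j = 0) (hA_rev : ∀ i j, μ i * A i j = μ j * A j i)
    (hB_off : ∀ i j, i ≠ j → 0 ≤ B i j) (hB_row : ∀ i, ∑ j, B i j = 0)
    (hB_rev : ∀ i j, μ i * B i j = μ j * B j i)
    (hB_erg : ∀ f : S → ℝ, B *ᵥ f = 0 → ∃ c : ℝ, ∀ i, f i = c)
    (u : S → ℝ) (hu : ∑ i, μ i * u i * (A *ᵥ u) i < ∑ i, μ i * u i * (B *ᵥ u) i) :
    ∃ v u₁ u₂ : S → ℝ, ∑ i, μ i * v i = 0 ∧ A *ᵥ u₁ = -v ∧ B *ᵥ u₂ = -v ∧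
      ∑ i, μ i * v i * u₁ i < ∑ i, μ i * v i * u₂ i := by
  have hmean := sum_mul_mulVec_eq_zero_of_reversible hA_row hA_rev u
  obtain ⟨u₂, hu₂⟩ :=
    exists_mulVec_eq_of_sum_mul_eq_zero hμ_sum hB_row hB_rev hB_erg (A *ᵥ u) hmean
  refine ⟨-(A *ᵥ u), u, u₂, by simpa using hmean, by simp, by simpa using hu₂, ?_⟩
  have hneg := sum_mul_mulVec_self_nonpos_of_reversible hμ_pos hB_off hB_row hB_rev (u₂ - u)
  have hsymm := sum_mul_mulVec_comm_of_reversible hB_rev u₂ u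
  have hexp : ∑ i, μ i * (u₂ - u) i * (B *ᵥ (u₂ - u)) i =
      ∑ i, μ i * u₂ i * (B *ᵥ u₂) i - ∑ i, μ i * u₂ i * (B *ᵥ u) i
        - ∑ i, μ i * u i * (B *ᵥ u₂) i + ∑ i, μ i * u i * (B *ᵥ u) i := by
    simp only [mulVec_sub, Pi.sub_apply, ← sum_add_distrib, ← sum_sub_distrib]
    exact sum_congr rfl fun i _ ↦ by ring
  rw [hu₂] at hexp hsymm
  have hneg_sum (f : S → ℝ) :
      ∑ i, μ i * (-(A *ᵥ u)) i * f i = -∑ i, μ i * f i * (A *ᵥ u) i := by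
    rw [← sum_neg_distrib]
    exact sum_congr rfl fun i _ ↦ by rw [Pi.neg_apply]; ring
  rw [hneg_sum, hneg_sum]
  linarith

/-- A nonzero symmetric matrix with zero diagonal takes a positive value as a quadratic form. -/
lemma exists_dotProduct_mulVec_pos [DecidableEq S] {D : Matrix S S ℝ} (hsymm : D.IsSymm)
    (hdiag : ∀ i, D i i = 0) (hD : D ≠ 0) : ∃ u : S → ℝ, 0 < u ⬝ᵥ D *ᵥ u := by
  obtain ⟨i, j, hij⟩ : ∃ i j, D i j ≠ 0 := by
    by_contra! h
    exact hD (Matrix.ext h)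
  refine ⟨Pi.single i 1 + Pi.single j (D i j), ?_⟩
  have hji : D j i = D i j := hsymm.apply i j
  simpa [mulVec_add, add_dotProduct, hdiag, hji] using hij

end ReversibleGenerator

/-- If `A` and `B` are irreducible Markov generators on a finite set `S`, both
reversible with respect to the same fully supported probability measure `μ`, with the same
total jump rate from each state (`A_{ii} = B_{ii}`), then either `A = B` or there exist
mean-zero `v, w` such that `Q_A(v) > Q_B(v)` and `Q_A(w) < Q_B(w)`, where
`Q_A(v) = ⟨v, u⟩_μ` for any solution `u` of `A u = -v`. -/
theorem reversible_generators_no_dominance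
    {S : Type*} [Fintype S] [DecidableEq S] [Nonempty S]
    (A B : Matrix S S ℝ) (μ : S → ℝ)
    -- A and B are Markov generators
    (hA_off : ∀ i j, i ≠ j → 0 ≤ A i j) (hA_row : ∀ i, ∑ j, A i j = 0)
    (hB_off : ∀ i j, i ≠ j → 0 ≤ B i j) (hB_row : ∀ i, ∑ j, B i j = 0)
    -- μ is a probability measure with full support
    (hμ_pos : ∀ i, 0 < μ i) (hμ_sum : ∑ i, μ i = 1)
    -- reversibility of A and B with respect to μ
    (hA_rev : ∀ i j, μ i * A i j = μ j * A j i)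
    (hB_rev : ∀ i j, μ i * B i j = μ j * B j i)
    -- irreducibility/ergodicity: kernels consist of the constant functions
    (hA_erg : ∀ f : S → ℝ, A *ᵥ f = 0 → ∃ c : ℝ, ∀ i, f i = c)
    (hB_erg : ∀ f : S → ℝ, B *ᵥ f = 0 → ∃ c : ℝ, ∀ i, f i = c)
    -- equal total jump rates from each state
    (h_diag : ∀ i, A i i = B i i) :
    A = B ∨
    ∃ v w u₁ u₂ u₃ u₄ : S → ℝ,
      (∑ i, μ i * v i = 0) ∧ (∑ i, μ i * w i = 0) ∧
      A *ᵥ u₁ = -v ∧ B *ᵥ u₂ = -v ∧ A *ᵥ u₃ = -w ∧ B *ᵥ u₄ = -w ∧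
      (∑ i, μ i * v i * u₁ i > ∑ i, μ i * v i * u₂ i) ∧
      (∑ i, μ i * w i * u₃ i < ∑ i, μ i * w i * u₄ i) := by
  refine or_iff_not_imp_left.mpr fun hAB ↦ ?_
  have key (C D : Matrix S S ℝ) (hC : ∀ i j, μ i * C i j = μ j * C j i)
      (hD : ∀ i j, μ i * D i j = μ j * D j i) (hdiag : ∀ i, C i i = D i i) (hne : C ≠ D) :
      ∃ u : S → ℝ, ∑ i, μ i * u i * (C *ᵥ u) i < ∑ i, μ i * u i * (D *ᵥ u) i := by
    obtain ⟨u, hu⟩ := exists_dotProduct_mulVec_pos (D := diagonal μ * (D - C))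
      (Matrix.ext fun i j ↦ by
        simp only [transpose_apply, diagonal_mul, Matrix.sub_apply]
        linear_combination hD j i - hC j i)
      (fun i ↦ by simp [hdiag])
      (fun h ↦ hne <| Matrix.ext fun i j ↦ by
        have hij := congrFun (congrFun h i) j
        simp only [diagonal_mul, Matrix.sub_apply, Matrix.zero_apply, mul_eq_zero, (hμ_pos i).ne',
          false_or] at hij
        linarith)
    refine ⟨u, ?_⟩
    rw [← sub_pos, ← sum_sub_distrib]
    convert hu using 1
    refine sum_congr rfl fun i _ ↦ ?_
    rw [← mulVec_mulVec, mulVec_diagonal, sub_mulVec, Pi.sub_apply]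
    ring
  obtain ⟨u, hu⟩ := key A B hA_rev hB_rev h_diag hAB
  obtain ⟨u', hu'⟩ := key B A hB_rev hA_rev (fun i ↦ (h_diag i).symm) (Ne.symm hAB)
  obtain ⟨w, u₃, u₄, hw, h₃, h₄, hlt⟩ := exists_poisson_lt_of_dirichlet_lt hμ_pos hμ_sum
    hA_row hA_rev hB_off hB_row hB_rev hB_erg u hu
  obtain ⟨v, u₂, u₁, hv, h₂, h₁, hgt⟩ := exists_poisson_lt_of_dirichlet_lt hμ_pos hμ_sum
    hB_row hB_rev hA_off hA_row hA_rev hA_erg u' hu'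
  exact ⟨v, w, u₁, u₂, u₃, u₄, hv, hw, h₁, h₂, h₃, h₄, hgt, hlt⟩
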